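/- Let G be a discrete group and L a length function on G with bounded doubling, say |B(2r)| ≤ C_L·|B(r)| for all r ≥ 1, and fix R = 2^K for an integer K ≥ 2. Then there is a constant C < ∞, depending only on C_L and R, such that for every finitely supported f : G → ℂ and every integer N ≥ 1, ‖λ_{p_N^f}‖ ≤ C · R^{−2N} · J_D(f), where p_N^f = Σ_{n≥N} g_{2n}·f. -/

import Mathlib

open scoped ENNReal ComplexConjugate

noncomputable section

variable {G : Type*}

/-- The Hilbert space `ℓ²(G)` of square-summable complex-valued functions on `G`. -/
abbrev l2 (G : Type*) : Type _ := lp (fun _ : G => ℂ) 2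

variable [Group G]

/-- A length function on a group `G`: subadditive, symmetric under inverses,
and vanishing exactly at the identity. -/
structure IsLengthFunction (L : G → ℝ) : Prop where
  nonneg : ∀ x, 0 ≤ L x
  subadd : ∀ x y, L (x * y) ≤ L x + L y
  inv_eq : ∀ x, L x⁻¹ = L x
  eq_zero_iff : ∀ x, L x = 0 ↔ x = 1

/-- The ball `B(r) = {x ∈ G : L x ≤ r}`. -/
def lball (L : G → ℝ) (r : ℝ) : Set G := {x : G | L x ≤ r}

/-- A length function is proper if all balls are finite. -/
def IsProperLF (L : G → ℝ) : Prop := ∀ r : ℝ, (lball L r).Finite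

/-- Bounded doubling: `L` is proper and there is `C < ∞` with
`|B(2r)| ≤ C |B(r)|` for all `r ≥ 1`. -/
def HasBoundedDoubling (L : G → ℝ) : Prop :=
  IsProperLF L ∧ ∃ C : ℝ, ∀ r : ℝ, 1 ≤ r →
    ((lball L (2 * r)).ncard : ℝ) ≤ C * ((lball L r).ncard : ℝ)

/-- `T` is the convolution operator `λ_f`, `(λ_f ξ)(x) = Σ_y f(xy⁻¹) ξ(y)`. -/
def IsConvOp (f : G → ℂ) (T : l2 G →L[ℂ] l2 G) : Prop :=
  ∀ (ξ : l2 G) (x : G), T ξ x = ∑' y : G, f (x * y⁻¹) * ξ y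

/-- `T` is the commutator `[D, λ_f]` for `D = M_L`, i.e.
`([D,λ_f] ξ)(x) = Σ_y (L x − L y) f(xy⁻¹) ξ(y)`. -/
def IsCommOp (L : G → ℝ) (f : G → ℂ) (T : l2 G →L[ℂ] l2 G) : Prop :=
  ∀ (ξ : l2 G) (x : G), T ξ x = ∑' y : G, ((L x : ℂ) - (L y : ℂ)) * f (x * y⁻¹) * ξ y

/-- `T` is the truncated operator `(I − M_{2r}) λ_f M_r`. -/
def IsTruncOp (L : G → ℝ) (f : G → ℂ) (r : ℝ) (T : l2 G →L[ℂ] l2 G) : Prop :=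
  ∀ (ξ : l2 G) (x : G),
    T ξ x = if L x ≤ 2 * r then 0
      else ∑' y : G, (if L y ≤ r then f (x * y⁻¹) * ξ y else 0)

/-- The seminorm `J_D(f) = sup_{r>0} r ‖(I − M_{2r}) λ_f M_r‖`. -/
def JD (L : G → ℝ) (f : G → ℂ) : ℝ :=
  sSup {a : ℝ | ∃ r : ℝ, 0 < r ∧ ∃ T : l2 G →L[ℂ] l2 G, IsTruncOp L f r T ∧ a = r * ‖T‖}

/-- The convolution `h* ∗ k`, where `h*(z) = conj (h z⁻¹)`. -/
def starConv (h k : G → ℂ) : G → ℂ :=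
  fun x => ∑' z : G, conj (h z⁻¹) * k (z⁻¹ * x)

/-- The `ℓ²` norm `‖h‖₂ = (Σ_x |h x|²)^{1/2}` of a function `h : G → ℂ`. -/
def l2norm (h : G → ℂ) : ℝ := Real.sqrt (∑' x : G, ‖h x‖ ^ 2)

/-- The complex-valued cutoff function `g_n = h_n* ∗ k_n`, where
`k_n = |B(R^{n-1})|⁻¹ χ_{B(R^{n-1})}` and `h_n = χ_{A(R^n, R^{n+1})}`. -/
def gCut (L : G → ℝ) (R : ℝ) (n : ℕ) : G → ℂ :=
  fun x => ∑' z : G,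
    (if R ^ n < L z⁻¹ ∧ L z⁻¹ ≤ R ^ (n + 1) then (1 : ℂ) else 0) *
      (((lball L (R ^ (n - 1))).ncard : ℂ)⁻¹ *
        if L (z⁻¹ * x) ≤ R ^ (n - 1) then 1 else 0)

open scoped Classical in
/-- The finitely supported element of `ℓ²` which agrees with `ξ` on `Y`. -/
def finVec {H : Type*} (Y : Finset H) (ξ : H → ℂ) : l2 H :=
  ∑ y ∈ Y, lp.single 2 y (ξ y)

open scoped Classical in
theorem finVec_apply {H : Type*} (Y : Finset H) (ξ : H → ℂ) (x : H) :
    finVec Y ξ x = if x ∈ Y then ξ x else 0 := by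
  simp only [finVec, lp.coeFn_sum, Finset.sum_apply, lp.coeFn_single]
  rw [Finset.sum_pi_single]

theorem norm_finVec {H : Type*} (Y : Finset H) (ξ : H → ℂ) :
    ‖finVec Y ξ‖ = √(∑ y ∈ Y, ‖ξ y‖ ^ 2) := by
  classical
  have h := lp.norm_sum_single (E := fun _ : H => ℂ) (p := 2) (by norm_num) ξ Y
  simp only [ENNReal.toReal_ofNat, Real.rpow_ofNat] at h
  rw [← h, Real.sqrt_sq (norm_nonneg _), finVec]

theorem tendsto_finVec {H : Type*} (ξ : l2 H) :
    Filter.Tendsto (fun Y : Finset H => finVec Y ξ) Filter.atTop (nhds ξ) := by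
  classical
  have h := lp.hasSum_single (E := fun _ : H => ℂ) (p := 2) (by norm_num) ξ
  simpa [HasSum, finVec] using h

theorem sqrt_sum_le_norm {H : Type*} (ξ : l2 H) (X : Finset H) :
    √(∑ x ∈ X, ‖ξ x‖ ^ 2) ≤ ‖ξ‖ := by
  have h := lp.sum_rpow_le_norm_rpow (E := fun _ : H => ℂ) (p := 2) (by norm_num) ξ X
  simp only [ENNReal.toReal_ofNat, Real.rpow_ofNat] at h
  exact Real.sqrt_le_iff.2 ⟨norm_nonneg _, h⟩

theorem norm_le_of_forall_sqrt_sum_le {H : Type*} (ξ : l2 H) {C : ℝ} (hC : 0 ≤ C)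
    (h : ∀ X : Finset H, √(∑ x ∈ X, ‖ξ x‖ ^ 2) ≤ C) : ‖ξ‖ ≤ C := by
  refine lp.norm_le_of_forall_sum_le (E := fun _ : H => ℂ) (p := 2) (by norm_num) hC fun X => ?_
  simp only [ENNReal.toReal_ofNat, Real.rpow_ofNat]
  exact (Real.sqrt_le_iff.1 (h X)).2

/-- Cauchy–Schwarz for a finite bilinear pairing. -/
theorem norm_sum_mul_le {H : Type*} (X : Finset H) (η ζ : H → ℂ) :
    ‖∑ x ∈ X, η x * ζ x‖ ≤ √(∑ x ∈ X, ‖η x‖ ^ 2) * √(∑ x ∈ X, ‖ζ x‖ ^ 2) := by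
  refine (norm_sum_le _ _).trans ?_
  simp only [norm_mul]
  exact Real.sum_mul_le_sqrt_mul_sqrt _ _ _

/-- An operator norm bound from a bound of the bilinear form on finitely supported vectors. -/
theorem opNorm_le_of_forall_finVec {H : Type*} (T : l2 H →L[ℂ] l2 H) {B : ℝ} (hB : 0 ≤ B)
    (h : ∀ (X Y : Finset H) (η ξ : H → ℂ), ‖∑ x ∈ X, η x * T (finVec Y ξ) x‖ ≤
      B * √(∑ x ∈ X, ‖η x‖ ^ 2) * √(∑ y ∈ Y, ‖ξ y‖ ^ 2)) : ‖T‖ ≤ B := by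
  have key : ∀ (Y : Finset H) (ξ : H → ℂ), ‖T (finVec Y ξ)‖ ≤ B * ‖finVec Y ξ‖ := by
    intro Y ξ
    refine norm_le_of_forall_sqrt_sum_le _ (by positivity) fun X => ?_
    have h1 := h X Y (fun x => conj (T (finVec Y ξ) x)) ξ
    rw [norm_finVec]
    have h2 : ∑ x ∈ X, conj (T (finVec Y ξ) x) * T (finVec Y ξ) x =
        ((∑ x ∈ X, ‖T (finVec Y ξ) x‖ ^ 2 : ℝ) : ℂ) := by
      push_cast
      exact Finset.sum_congr rfl fun x _ => Complex.conj_mul' _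
    have h0 : 0 ≤ ∑ x ∈ X, ‖T (finVec Y ξ) x‖ ^ 2 := by positivity
    rw [h2, Complex.norm_real, Real.norm_of_nonneg h0] at h1
    simp only [RCLike.norm_conj] at h1
    set s := √(∑ x ∈ X, ‖T (finVec Y ξ) x‖ ^ 2) with hs
    have hss : ∑ x ∈ X, ‖T (finVec Y ξ) x‖ ^ 2 = s * s := (Real.mul_self_sqrt h0).symm
    rw [hss] at h1
    have hs0 : 0 ≤ s := Real.sqrt_nonneg _
    rcases hs0.eq_or_lt with h3 | h3
    · rw [← h3]; positivity
    · refine le_of_mul_le_mul_right (h1.trans (le_of_eq ?_)) h3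
      ring
  refine T.opNorm_le_bound hB fun ξ => ?_
  have hlim := tendsto_finVec ξ
  exact le_of_tendsto_of_tendsto' ((T.continuous.tendsto ξ).comp hlim).norm
    (hlim.norm.const_mul B) fun Y => key Y ξ

theorem IsConvOp.apply_finVec {a : G → ℂ} {T : l2 G →L[ℂ] l2 G} (hT : IsConvOp a T)
    (Y : Finset G) (ξ : G → ℂ) (x : G) :
    T (finVec Y ξ) x = ∑ y ∈ Y, a (x * y⁻¹) * ξ y := by
  rw [hT, tsum_eq_sum (s := Y)]
  · exact Finset.sum_congr rfl fun y hy => by rw [finVec_apply, if_pos hy]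
  · intro y hy
    rw [finVec_apply, if_neg hy, mul_zero]

theorem IsTruncOp.apply_finVec {L : G → ℝ} {f : G → ℂ} {r : ℝ} {T : l2 G →L[ℂ] l2 G}
    (hT : IsTruncOp L f r T) {Y : Finset G} (hY : ∀ y ∈ Y, L y ≤ r) (ξ : G → ℂ) {x : G}
    (hx : 2 * r < L x) :
    T (finVec Y ξ) x = ∑ y ∈ Y, f (x * y⁻¹) * ξ y := by
  rw [hT, if_neg hx.not_ge, tsum_eq_sum (s := Y)]
  · exact Finset.sum_congr rfl fun y hy => by rw [if_pos (hY y hy), finVec_apply, if_pos hy]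
  · intro y hy
    rw [finVec_apply, if_neg hy, mul_zero, ite_self]

theorem IsTruncOp.unique {L : G → ℝ} {f : G → ℂ} {r : ℝ} {S T : l2 G →L[ℂ] l2 G}
    (hS : IsTruncOp L f r S) (hT : IsTruncOp L f r T) : S = T := by
  ext ξ x
  rw [hS, hT]

theorem norm_evalCLM_le {H : Type*} (y : H) :
    ‖(lp.evalCLM ℂ (fun _ : H => ℂ) 2 y : l2 H →L[ℂ] ℂ)‖ ≤ 1 :=
  ContinuousLinearMap.opNorm_le_bound _ zero_le_one fun ξ => by
    rw [one_mul]
    exact lp.norm_apply_le_norm (by norm_num) ξ y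

theorem exists_isTruncOp {L : G → ℝ} (hP : IsProperLF L) (f : G →₀ ℂ) (r : ℝ) :
    ∃ T : l2 G →L[ℂ] l2 G, IsTruncOp L f r T ∧
      ‖T‖ ≤ (lball L r).ncard * ∑ s ∈ f.support, ‖f s‖ := by
  classical
  refine ⟨∑ y ∈ (hP r).toFinset, ∑ s ∈ f.support,
    (if L (s * y) ≤ 2 * r then 0 else f s) •
      (lp.singleContinuousLinearMap ℂ (fun _ : G => ℂ) 2 (s * y)).comp
        (lp.evalCLM ℂ (fun _ : G => ℂ) 2 y), ?_, ?_⟩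
  · intro ξ x
    have h1 : (∑' y : G, (if L y ≤ r then f (x * y⁻¹) * ξ y else 0)) =
        ∑ y ∈ (hP r).toFinset, f (x * y⁻¹) * ξ y := by
      rw [tsum_eq_sum (s := (hP r).toFinset)]
      · refine Finset.sum_congr rfl fun y hy => if_pos ?_
        simpa [lball] using hy
      · intro y hy
        exact if_neg (by simpa [lball] using hy)
    have h2 : ∀ y : G, ∑ s ∈ f.support, (if L (s * y) ≤ 2 * r then 0 else f s) *
        (Pi.single (s * y) (ξ y) : G → ℂ) x =
        if L x ≤ 2 * r then 0 else f (x * y⁻¹) * ξ y := by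
      intro y
      rw [Finset.sum_eq_single (x * y⁻¹)]
      · simp only [inv_mul_cancel_right, Pi.single_eq_same, ite_mul, zero_mul]
      · intro s _ hs
        rw [Pi.single_eq_of_ne, mul_zero]
        rintro rfl
        simp at hs
      · intro hs
        simp [Finsupp.notMem_support_iff.1 hs]
    rw [h1]
    simp only [sum_apply, smul_apply,
      ContinuousLinearMap.comp_apply, lp.singleContinuousLinearMap_apply, lp.coeFn_sum,
      Finset.sum_apply, lp.coeFn_smul, Pi.smul_apply, smul_eq_mul, lp.coeFn_single]
    refine (Finset.sum_congr rfl fun y _ => h2 y).trans ?_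
    split_ifs <;> simp
  · refine (norm_sum_le _ _).trans ?_
    rw [Set.ncard_eq_toFinset_card _ (hP r), ← nsmul_eq_mul]
    refine Finset.sum_le_card_nsmul _ _ _ fun y _ => (norm_sum_le _ _).trans ?_
    refine Finset.sum_le_sum fun s _ => ?_
    rw [norm_smul]
    have h1 : ‖(if L (s * y) ≤ 2 * r then 0 else f s : ℂ)‖ ≤ ‖f s‖ := by
      split_ifs <;> simp
    have h2 : ‖(lp.singleContinuousLinearMap ℂ (fun _ : G => ℂ) 2 (s * y)).comp
        (lp.evalCLM ℂ (fun _ : G => ℂ) 2 y)‖ ≤ 1 := by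
      refine (ContinuousLinearMap.opNorm_comp_le _ _).trans ?_
      refine mul_le_one₀ ?_ (norm_nonneg _) (norm_evalCLM_le y)
      refine ContinuousLinearMap.opNorm_le_bound _ zero_le_one fun c => ?_
      rw [one_mul, lp.singleContinuousLinearMap_apply, lp.norm_single (by norm_num)]
    calc _ ≤ ‖f s‖ * 1 := by gcongr
      _ = ‖f s‖ := mul_one _

theorem IsLengthFunction.le_mul_inv_add {L : G → ℝ} (hL : IsLengthFunction L) (x y : G) :
    L x ≤ L (x * y⁻¹) + L y := by
  simpa using hL.subadd (x * y⁻¹) y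

theorem Finsupp.exists_length_le {H : Type*} {L : H → ℝ} (f : H →₀ ℂ) :
    ∃ ρ : ℝ, ∀ x, f x ≠ 0 → L x ≤ ρ := by
  obtain ⟨ρ, hρ⟩ := (f.support.image L).bddAbove
  exact ⟨ρ, fun x hx => hρ (by
    simpa using ⟨x, hx, rfl⟩)⟩

theorem bddAbove_JD {L : G → ℝ} (hL : IsLengthFunction L) (hP : IsProperLF L) (f : G →₀ ℂ) :
    BddAbove {a : ℝ | ∃ r : ℝ, 0 < r ∧
      ∃ T : l2 G →L[ℂ] l2 G, IsTruncOp L f r T ∧ a = r * ‖T‖} := by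
  obtain ⟨ρ, hρ⟩ := Finsupp.exists_length_le (L := L) f
  refine ⟨|ρ| * ((lball L |ρ|).ncard * ∑ s ∈ f.support, ‖f s‖), ?_⟩
  rintro _ ⟨r, hr, T, hT, rfl⟩
  by_cases h : r ≤ |ρ|
  · obtain ⟨S, hS, hS'⟩ := exists_isTruncOp hP f r
    rw [hT.unique hS]
    have hsub : lball L r ⊆ lball L |ρ| := fun x hx => le_trans hx h
    have hc := Set.ncard_le_ncard hsub (hP _)
    refine mul_le_mul h (hS'.trans ?_) (norm_nonneg _) (abs_nonneg _)
    gcongr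
  · have hT0 : T = 0 := by
      refine hT.unique fun ξ x => ?_
      split_ifs with hx
      · simp
      · symm
        refine (tsum_congr fun y => ?_).trans tsum_zero
        split_ifs with hy
        · have h0 : f (x * y⁻¹) = 0 := by
            by_contra h0
            have h1 := hρ _ h0
            have h2 := hL.le_mul_inv_add x y
            have h3 := le_abs_self ρ
            push Not at hx h
            linarith
          rw [h0, zero_mul]
        · rfl
    rw [hT0, norm_zero, mul_zero]
    positivity

theorem JD_nonneg (L : G → ℝ) (f : G → ℂ) : 0 ≤ JD L f := by
  refine Real.sSup_nonneg ?_
  rintro _ ⟨r, hr, T, _, rfl⟩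
  positivity

/-- The bilinear form of the truncated operator is bounded by `r⁻¹ J_D(f)`. -/
theorem norm_sum_trunc_le {L : G → ℝ} (hL : IsLengthFunction L) (hP : IsProperLF L)
    (f : G →₀ ℂ) {r : ℝ} (hr : 0 < r) {X Y : Finset G} (hX : ∀ x ∈ X, 2 * r < L x)
    (hY : ∀ y ∈ Y, L y ≤ r) (η ξ : G → ℂ) :
    ‖∑ x ∈ X, η x * ∑ y ∈ Y, f (x * y⁻¹) * ξ y‖ ≤
      r⁻¹ * JD L f * √(∑ x ∈ X, ‖η x‖ ^ 2) * √(∑ y ∈ Y, ‖ξ y‖ ^ 2) := by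
  obtain ⟨T, hT, -⟩ := exists_isTruncOp hP f r
  have hJ : r * ‖T‖ ≤ JD L f := le_csSup (bddAbove_JD hL hP f) ⟨r, hr, T, hT, rfl⟩
  have hJ' : ‖T‖ ≤ r⁻¹ * JD L f := by
    rwa [inv_mul_eq_div, le_div_iff₀ hr, mul_comm]
  have h1 : ∑ x ∈ X, η x * ∑ y ∈ Y, f (x * y⁻¹) * ξ y =
      ∑ x ∈ X, η x * T (finVec Y ξ) x :=
    Finset.sum_congr rfl fun x hx => by rw [hT.apply_finVec hY ξ (hX x hx)]
  rw [h1]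
  calc _ ≤ √(∑ x ∈ X, ‖η x‖ ^ 2) * √(∑ x ∈ X, ‖T (finVec Y ξ) x‖ ^ 2) :=
        norm_sum_mul_le _ _ _
    _ ≤ √(∑ x ∈ X, ‖η x‖ ^ 2) * (‖T‖ * ‖finVec Y ξ‖) := by
        gcongr
        exact (sqrt_sum_le_norm _ _).trans (T.le_opNorm _)
    _ ≤ √(∑ x ∈ X, ‖η x‖ ^ 2) * (r⁻¹ * JD L f * ‖finVec Y ξ‖) := by gcongr
    _ = _ := by rw [norm_finVec]; ring

/-- Right-translated version of `norm_sum_trunc_le`. -/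
theorem norm_sum_trunc_translate_le {L : G → ℝ} (hL : IsLengthFunction L) (hP : IsProperLF L)
    (f : G →₀ ℂ) {r : ℝ} (hr : 0 < r) (w : G) {X Y : Finset G}
    (hX : ∀ x ∈ X, 2 * r < L (w * x⁻¹)) (hY : ∀ y ∈ Y, L (w * y⁻¹) ≤ r) (η ξ : G → ℂ) :
    ‖∑ x ∈ X, η x * ∑ y ∈ Y, f (x * y⁻¹) * ξ y‖ ≤
      r⁻¹ * JD L f * √(∑ x ∈ X, ‖η x‖ ^ 2) * √(∑ y ∈ Y, ‖ξ y‖ ^ 2) := by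
  have hswap : ∀ x, L (x * w⁻¹) = L (w * x⁻¹) := fun x => by
    rw [← hL.inv_eq (x * w⁻¹)]; simp
  have h := norm_sum_trunc_le hL hP f hr (X := X.map (mulRightEmbedding w⁻¹))
    (Y := Y.map (mulRightEmbedding w⁻¹))
    (by simpa [hswap] using hX) (by simpa [hswap] using hY)
    (fun x => η (x * w)) (fun y => ξ (y * w))
  simpa [Finset.sum_map, mul_assoc] using h

theorem gCut_mul_inv_eq_sum {L : G → ℝ} {R : ℝ} (m : ℕ) {x : G} (y : G) {W : Finset G}
    (hW : ∀ w, L (w * x⁻¹) ≤ R ^ (m + 1) → w ∈ W) :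
    gCut L R m (x * y⁻¹) = ∑ w ∈ W,
      (if R ^ m < L (w * x⁻¹) ∧ L (w * x⁻¹) ≤ R ^ (m + 1) then (1 : ℂ) else 0) *
      (((lball L (R ^ (m - 1))).ncard : ℂ)⁻¹ *
        if L (w * y⁻¹) ≤ R ^ (m - 1) then 1 else 0) := by
  rw [gCut, ← ((Equiv.inv G).trans (Equiv.mulLeft x)).tsum_eq, tsum_eq_sum (s := W)]
  · refine Finset.sum_congr rfl fun w _ => ?_
    simp [mul_assoc]
  · intro w hw
    have h1 : ¬ L (w * x⁻¹) ≤ R ^ (m + 1) := fun h => hw (hW w h)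
    simp [h1]

/-- Averaging over translates: the total mass of restrictions to translated balls. -/
theorem sum_sum_filter_le {L : G → ℝ} (hP : IsProperLF L) (t : ℝ)
    (W X : Finset G) (p : G → G → Prop) [∀ w x, Decidable (p w x)]
    (hp : ∀ w x, p w x → L (w * x⁻¹) ≤ t) (η : G → ℝ) (hη : ∀ x, 0 ≤ η x) :
    ∑ w ∈ W, ∑ x ∈ X with p w x, η x ≤ (lball L t).ncard * ∑ x ∈ X, η x := by
  classical
  simp only [Finset.sum_filter]
  rw [Finset.sum_comm, Finset.mul_sum]
  refine Finset.sum_le_sum fun x _ => ?_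
  rw [← Finset.sum_filter, Finset.sum_const, nsmul_eq_mul]
  refine mul_le_mul_of_nonneg_right ?_ (hη x)
  rw [Set.ncard_eq_toFinset_card _ (hP t)]
  exact_mod_cast Finset.card_le_card_of_injOn (fun w => w * x⁻¹)
    (fun w hw => by
      simp only [Finset.coe_filter, Set.mem_ofPred_eq] at hw
      simpa [lball] using hp w x hw.2)
    (fun a _ b _ hab => mul_right_cancel hab)

/-- The bilinear form of `λ_{g_m f}` is bounded by `(|B(R^{m+1})| / |B(R^{m-1})|)^{1/2} R^{1-m}`
times `J_D(f)`. -/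
theorem norm_sum_gCut_mul_le {L : G → ℝ} (hL : IsLengthFunction L) (hP : IsProperLF L)
    (f : G →₀ ℂ) {R : ℝ} (hR : 2 ≤ R) {m : ℕ} (hm : 1 ≤ m) {D : ℝ} (hD : 0 ≤ D)
    (hdoub : ((lball L (R ^ (m + 1))).ncard : ℝ) ≤ D ^ 2 * (lball L (R ^ (m - 1))).ncard)
    (X Y : Finset G) (η ξ : G → ℂ) :
    ‖∑ x ∈ X, η x * ∑ y ∈ Y, (gCut L R m (x * y⁻¹) * f (x * y⁻¹)) * ξ y‖ ≤
      D * ((R ^ (m - 1))⁻¹ * JD L f) * √(∑ x ∈ X, ‖η x‖ ^ 2) * √(∑ y ∈ Y, ‖ξ y‖ ^ 2) := by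
  classical
  set r : ℝ := R ^ (m - 1) with hr
  have hr0 : 0 < r := by positivity
  set t : ℝ := R ^ (m + 1) with ht
  have hRm : 2 * r ≤ R ^ m := by
    obtain ⟨k, rfl⟩ := Nat.exists_eq_add_of_le' hm
    rw [hr, Nat.add_sub_cancel, pow_succ']
    gcongr
  set b : ℝ := ((lball L r).ncard : ℝ) with hb
  have hb0 : 0 < b := by
    have h1 : (1 : G) ∈ lball L r := by
      change L 1 ≤ r
      rw [(hL.eq_zero_iff 1).2 rfl]
      exact hr0.le
    have := Set.ncard_pos (hP r) |>.2 ⟨1, h1⟩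
    exact Nat.cast_pos.2 this
  set W : Finset G := X.biUnion fun x => (hP t).toFinset.image (· * x) with hWdef
  have hW : ∀ x ∈ X, ∀ w, L (w * x⁻¹) ≤ t → w ∈ W := by
    intro x hx w hw
    simp only [hWdef, Finset.mem_biUnion, Finset.mem_image, Set.Finite.mem_toFinset]
    exact ⟨x, hx, w * x⁻¹, hw, by simp⟩
  have hsum : ∑ x ∈ X, η x * ∑ y ∈ Y, (gCut L R m (x * y⁻¹) * f (x * y⁻¹)) * ξ y =
      ∑ w ∈ W, (b : ℂ)⁻¹ * ∑ x ∈ X with R ^ m < L (w * x⁻¹) ∧ L (w * x⁻¹) ≤ t,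
        η x * ∑ y ∈ Y with L (w * y⁻¹) ≤ r, f (x * y⁻¹) * ξ y := by
    have hx : ∀ x ∈ X, η x * ∑ y ∈ Y, (gCut L R m (x * y⁻¹) * f (x * y⁻¹)) * ξ y =
        ∑ w ∈ W, (b : ℂ)⁻¹ * if R ^ m < L (w * x⁻¹) ∧ L (w * x⁻¹) ≤ t then
          η x * ∑ y ∈ Y with L (w * y⁻¹) ≤ r, f (x * y⁻¹) * ξ y else 0 := by
      intro x hx
      rw [Finset.sum_congr rfl fun y _ => by rw [gCut_mul_inv_eq_sum m y (hW x hx)]]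
      simp only [Finset.sum_mul, Finset.mul_sum, ← ht, ← hr]
      rw [Finset.sum_comm]
      refine Finset.sum_congr rfl fun w _ => ?_
      by_cases h1 : R ^ m < L (w * x⁻¹) ∧ L (w * x⁻¹) ≤ t
      · simp only [if_pos h1, Finset.sum_filter]
        rw [Finset.mul_sum]
        refine Finset.sum_congr rfl fun y _ => ?_
        split_ifs
        · simp only [hb, Complex.ofReal_natCast]
          ring
        · ring
      · simp only [if_neg h1, mul_zero, zero_mul, Finset.sum_const_zero]
    rw [Finset.sum_congr rfl hx, Finset.sum_comm]
    refine Finset.sum_congr rfl fun w _ => ?_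
    rw [Finset.sum_filter, Finset.mul_sum]
  set J := JD L f
  have hJ : 0 ≤ J := JD_nonneg L f
  set P : ℝ := ∑ x ∈ X, ‖η x‖ ^ 2
  set Q : ℝ := ∑ y ∈ Y, ‖ξ y‖ ^ 2
  have hP0 : 0 ≤ P := by positivity
  rw [hsum]
  calc _ ≤ ∑ w ∈ W, b⁻¹ * (r⁻¹ * J *
        √(∑ x ∈ X with R ^ m < L (w * x⁻¹) ∧ L (w * x⁻¹) ≤ t, ‖η x‖ ^ 2) *
        √(∑ y ∈ Y with L (w * y⁻¹) ≤ r, ‖ξ y‖ ^ 2)) := by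
        refine (norm_sum_le _ _).trans (Finset.sum_le_sum fun w _ => ?_)
        rw [norm_mul, norm_inv, Complex.norm_real, Real.norm_of_nonneg hb0.le]
        refine mul_le_mul_of_nonneg_left ?_ (by positivity)
        refine norm_sum_trunc_translate_le hL hP f hr0 w ?_ ?_ η ξ
        · intro x hx
          exact hRm.trans_lt (Finset.mem_filter.1 hx).2.1
        · intro y hy
          exact (Finset.mem_filter.1 hy).2
    _ = b⁻¹ * (r⁻¹ * J) * ∑ w ∈ W,
        √(∑ x ∈ X with R ^ m < L (w * x⁻¹) ∧ L (w * x⁻¹) ≤ t, ‖η x‖ ^ 2) *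
        √(∑ y ∈ Y with L (w * y⁻¹) ≤ r, ‖ξ y‖ ^ 2) := by
        rw [Finset.mul_sum]
        exact Finset.sum_congr rfl fun w _ => by ring
    _ ≤ b⁻¹ * (r⁻¹ * J) *
        (√(∑ w ∈ W, ∑ x ∈ X with R ^ m < L (w * x⁻¹) ∧ L (w * x⁻¹) ≤ t, ‖η x‖ ^ 2) *
        √(∑ w ∈ W, ∑ y ∈ Y with L (w * y⁻¹) ≤ r, ‖ξ y‖ ^ 2)) := by
        gcongr
        exact Real.sum_sqrt_mul_sqrt_le _ (fun w => by positivity) (fun w => by positivity)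
    _ ≤ b⁻¹ * (r⁻¹ * J) * (√(D ^ 2 * b * P) * √(b * Q)) := by
        gcongr
        · refine (sum_sum_filter_le hP t W X _ (fun w x h => h.2) (fun x => ‖η x‖ ^ 2)
            (fun x => by positivity)).trans ?_
          exact mul_le_mul_of_nonneg_right hdoub hP0
        · exact sum_sum_filter_le hP r W Y _ (fun w x h => h) (fun x => ‖ξ x‖ ^ 2)
            (fun x => by positivity)
    _ = b⁻¹ * (r⁻¹ * J) * (D * (√b * √b) * √P * √Q) := by
        rw [Real.sqrt_mul (by positivity), Real.sqrt_mul (by positivity), Real.sqrt_sq hD,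
          Real.sqrt_mul hb0.le]
        ring
    _ = D * (r⁻¹ * J) * √P * √Q := by
        rw [Real.mul_self_sqrt hb0.le]
        field_simp

theorem ncard_lball_two_pow_mul_le {H : Type*} {L : H → ℝ} {CL : ℝ} (hCL : 0 ≤ CL)
    (h : ∀ r : ℝ, 1 ≤ r → ((lball L (2 * r)).ncard : ℝ) ≤ CL * ((lball L r).ncard : ℝ))
    (j : ℕ) {r : ℝ} (hr : 1 ≤ r) :
    ((lball L (2 ^ j * r)).ncard : ℝ) ≤ CL ^ j * ((lball L r).ncard : ℝ) := by
  induction j with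
  | zero => simp
  | succ j ih =>
    have h1 : 1 ≤ 2 ^ j * r := one_le_mul_of_one_le_of_one_le (one_le_pow₀ one_le_two) hr
    calc ((lball L (2 ^ (j + 1) * r)).ncard : ℝ) = (lball L (2 * (2 ^ j * r))).ncard := by
          rw [pow_succ', mul_assoc]
      _ ≤ CL * (lball L (2 ^ j * r)).ncard := h _ h1
      _ ≤ CL * (CL ^ j * (lball L r).ncard) := by gcongr
      _ = _ := by ring

theorem doubling_const_nonneg {L : G → ℝ} (hL : IsLengthFunction L) (hP : IsProperLF L) {CL : ℝ}
    (h : ∀ r : ℝ, 1 ≤ r → ((lball L (2 * r)).ncard : ℝ) ≤ CL * ((lball L r).ncard : ℝ)) :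
    0 ≤ CL := by
  have h1 : (1 : G) ∈ lball L 1 := by
    change L 1 ≤ 1
    rw [(hL.eq_zero_iff 1).2 rfl]
    exact zero_le_one
  have h2 : (0 : ℝ) < (lball L 1).ncard := by
    exact_mod_cast Set.ncard_pos (hP 1) |>.2 ⟨1, h1⟩
  exact nonneg_of_mul_nonneg_left ((Nat.cast_nonneg _).trans (h 1 le_rfl)) h2

theorem gCut_eq_zero {L : G → ℝ} (hL : IsLengthFunction L) {R : ℝ} (hR : 2 ≤ R) {m : ℕ}
    (hm : 1 ≤ m) {x : G} (hx : L x ≤ R ^ (m - 1)) : gCut L R m x = 0 := by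
  refine (tsum_congr fun z => ?_).trans tsum_zero
  split_ifs with h1 h2
  · exfalso
    have h3 := hL.le_mul_inv_add z⁻¹ x⁻¹
    rw [inv_inv, hL.inv_eq x] at h3
    have hRm : 2 * R ^ (m - 1) ≤ R ^ m := by
      obtain ⟨k, rfl⟩ := Nat.exists_eq_add_of_le' hm
      rw [Nat.add_sub_cancel, pow_succ']
      gcongr
    linarith [h1.1]
  all_goals simp

theorem sum_pow_ite_le {q : ℝ} (hq : 0 ≤ q) (hq' : q ≤ 1 / 2) (N M : ℕ) :
    ∑ n ∈ Finset.range M, (if N ≤ n then q ^ n else 0) ≤ 2 * q ^ N := by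
  have key : ∀ M, N ≤ M →
      ∑ n ∈ Finset.range M, (if N ≤ n then q ^ n else 0) ≤ 2 * q ^ N - 2 * q ^ M := by
    intro M hM
    induction M, hM using Nat.le_induction with
    | base =>
      rw [sub_self]
      exact (Finset.sum_eq_zero fun n hn => if_neg (by simpa using hn)).le
    | succ M hM ih =>
      rw [Finset.sum_range_succ, if_pos hM, pow_succ]
      nlinarith [pow_nonneg hq M]
  rcases le_total N M with h | h
  · linarith [key M h, pow_nonneg hq M]
  · rw [Finset.sum_eq_zero fun n hn => if_neg (by simp at hn; omega)]
    positivity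

/-- there is `C < ∞`, depending only on the doubling constant `C_L`
and `R = 2^K` (`K ≥ 2`), such that `‖λ_{p_N^f}‖ ≤ C R^{−2N} J_D(f)` where
`p_N^f = Σ_{n≥N} g_{2n}·f`, for every finitely supported `f` and every `N ≥ 1`. -/
theorem exists_const_norm_pN_le :
    ∀ (CL : ℝ) (K : ℕ), 2 ≤ K →
    ∃ C : ℝ, ∀ (G : Type*) [Group G] (L : G → ℝ),
      IsLengthFunction L → IsProperLF L →
      (∀ r : ℝ, 1 ≤ r →
        ((lball L (2 * r)).ncard : ℝ) ≤ CL * ((lball L r).ncard : ℝ)) →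
      ∀ f : G →₀ ℂ, ∀ N : ℕ, 1 ≤ N → ∀ T : l2 G →L[ℂ] l2 G,
        IsConvOp (fun x =>
          (∑' n : ℕ, if N ≤ n then gCut L ((2 : ℝ) ^ K) (2 * n) x else 0) * f x) T →
        ‖T‖ ≤ C * (((2 : ℝ) ^ K) ^ (2 * N))⁻¹ * JD L (f : G → ℂ) := by
  intro CL K hK
  refine ⟨2 * 2 ^ K * CL ^ K, ?_⟩
  intro G _ L hL hP hdoub f N hN T hT
  have hCL := doubling_const_nonneg hL hP hdoub
  set R : ℝ := 2 ^ K with hRdef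
  have hR : 2 ≤ R := by
    calc (2 : ℝ) = 2 ^ 1 := (pow_one 2).symm
      _ ≤ 2 ^ K := pow_le_pow_right₀ one_le_two (by omega)
  have hR0 : 0 < R := by positivity
  clear_value R
  have hJ := JD_nonneg L (f : G → ℂ)
  obtain ⟨ρ, hρ⟩ := Finsupp.exists_length_le (L := L) f
  obtain ⟨M, hM⟩ := exists_nat_ge ρ
  have hkernel : ∀ x : G,
      (∑' n : ℕ, if N ≤ n then gCut L R (2 * n) x else 0) * f x =
        ∑ n ∈ Finset.range M, if N ≤ n then gCut L R (2 * n) x * f x else 0 := by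
    intro x
    by_cases hx : f x = 0
    · simp [hx]
    · rw [tsum_eq_sum (s := Finset.range M), Finset.sum_mul]
      · simp only [ite_mul, zero_mul]
      · intro n hn
        split_ifs with hNn
        · refine gCut_eq_zero hL hR (by omega) ?_
          have h1 : M ≤ n := by simpa using hn
          have h2 : n ≤ 2 * n - 1 := by omega
          calc L x ≤ ρ := hρ x hx
            _ ≤ M := hM
            _ ≤ ((2 * n - 1 : ℕ) : ℝ) := by exact_mod_cast h1.trans h2
            _ ≤ 2 ^ (2 * n - 1) := by exact_mod_cast Nat.lt_two_pow_self.le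
            _ ≤ R ^ (2 * n - 1) := by gcongr
        · rfl
  have hball : ∀ n, 1 ≤ n → ((lball L (R ^ (2 * n + 1))).ncard : ℝ) ≤
      (CL ^ K) ^ 2 * (lball L (R ^ (2 * n - 1))).ncard := by
    intro n hn
    have h1 := ncard_lball_two_pow_mul_le hCL hdoub (K * 2)
      (one_le_pow₀ (by linarith : 1 ≤ R) (n := 2 * n - 1))
    have h2 : (2 : ℝ) ^ (K * 2) * R ^ (2 * n - 1) = R ^ (2 * n + 1) := by
      rw [pow_mul, ← hRdef, ← pow_add]
      congr 1
      omega
    rwa [h2, pow_mul] at h1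
  set q : ℝ := (R ^ 2)⁻¹ with hq
  have hq0 : 0 ≤ q := by positivity
  have hq1 : q ≤ 1 / 2 := by
    rw [hq, one_div]
    exact inv_anti₀ two_pos (by nlinarith)
  refine opNorm_le_of_forall_finVec T (by positivity) fun X Y η ξ => ?_
  set P := √(∑ x ∈ X, ‖η x‖ ^ 2)
  set Q := √(∑ y ∈ Y, ‖ξ y‖ ^ 2)
  have hsum : ∑ x ∈ X, η x * T (finVec Y ξ) x = ∑ n ∈ Finset.range M, if N ≤ n then
      ∑ x ∈ X, η x * ∑ y ∈ Y, (gCut L R (2 * n) (x * y⁻¹) * f (x * y⁻¹)) * ξ y else 0 := by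
    have hx : ∀ x ∈ X, η x * T (finVec Y ξ) x = ∑ n ∈ Finset.range M, if N ≤ n then
        η x * ∑ y ∈ Y, (gCut L R (2 * n) (x * y⁻¹) * f (x * y⁻¹)) * ξ y else 0 := by
      intro x _
      simp only [hT.apply_finVec, hkernel, Finset.sum_mul, Finset.mul_sum]
      rw [Finset.sum_comm]
      refine Finset.sum_congr rfl fun n _ => ?_
      split_ifs <;> simp
    rw [Finset.sum_congr rfl hx, Finset.sum_comm]
    refine Finset.sum_congr rfl fun n _ => ?_
    split_ifs <;> simp
  rw [hsum]
  calc _ ≤ ∑ n ∈ Finset.range M, (if N ≤ n then q ^ n else 0) *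
        (R * CL ^ K * JD L f * P * Q) := by
        refine (norm_sum_le _ _).trans (Finset.sum_le_sum fun n _ => ?_)
        split_ifs with hNn
        · have h1 := norm_sum_gCut_mul_le hL hP f hR (m := 2 * n) (by omega)
            (D := CL ^ K) (by positivity) (hball n (by omega)) X Y η ξ
          refine h1.trans (le_of_eq ?_)
          have h2 : (R ^ (2 * n - 1))⁻¹ = q ^ n * R := by
            rw [hq, inv_pow, ← pow_mul]
            obtain ⟨k, hk⟩ : ∃ k, 2 * n = k + 1 := ⟨2 * n - 1, by omega⟩
            rw [hk, Nat.add_sub_cancel, pow_succ, mul_inv, inv_mul_cancel_right₀ hR0.ne']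
          rw [h2]
          ring
        · simp
    _ = (∑ n ∈ Finset.range M, (if N ≤ n then q ^ n else 0)) *
        (R * CL ^ K * JD L f * P * Q) := by rw [Finset.sum_mul]
    _ ≤ 2 * q ^ N * (R * CL ^ K * JD L f * P * Q) := by
        gcongr
        exact sum_pow_ite_le hq0 hq1 N M
    _ = _ := by
        rw [hq, inv_pow, ← pow_mul]
        ring
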